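/- Let R = ℂ[x1,x2,x3,x4], let b, c, e be the ℂ-algebra automorphisms of R determined by b: (x1,x2,x3,x4) ↦ (−x1,−x2,x3,x4), c: (x1,x2,x3,x4) ↦ (x1,x2,−x3,−x4), e: (x1,x2,x3,x4) ↦ (x3,x4,x1,x2), let G be the subgroup of algebra automorphisms generated by {b,c,e}, and let A = R#G be the skew group algebra. Let [A,A] denote the ℂ-linear span in A of all commutators xy − yx, let Q = A/[A,A] be the quotient ℂ-vector space, and let π : A → Q be the projection. Then there is no ℂ-bilinear map ⟨−,−⟩ : Q × Q → Q satisfying all of the following: (i) ⟨q,q⟩ = 0 for all q ∈ Q (antisymmetry); (ii) the Jacobi identity ⟨q,⟨r,s⟩⟩ + ⟨r,⟨s,q⟩⟩ + ⟨s,⟨q,r⟩⟩ = 0 for all q,r,s ∈ Q; (iii) for every a ∈ A there exists a ℂ-linear derivation dₐ : A → A (dₐ(xy) = dₐ(x)y + x·dₐ(y)) such that ⟨π(a), π(x)⟩ = π(dₐ(x)) for all x ∈ A; (iv) for all φ, ψ ∈ R fixed by every element of G, ⟨π(φ·δ_1), π(ψ·δ_1)⟩ = π({φ,ψ}·δ_1),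 where {−,−} is the standard symplectic Poisson bracket on R. -/

import Mathlib

open MvPolynomial

/-- The standard symplectic Poisson bracket on `ℂ[x₁,x₂,x₃,x₄]`:
`{φ,ψ} = φ_{x₁} ψ_{x₂} − φ_{x₂} ψ_{x₁} + φ_{x₃} ψ_{x₄} − φ_{x₄} ψ_{x₃}`. -/
noncomputable def poissonBracket (φ ψ : MvPolynomial (Fin 4) ℂ) :
    MvPolynomial (Fin 4) ℂ :=
  pderiv 0 φ * pderiv 1 ψ - pderiv 1 φ * pderiv 0 ψ +
    pderiv 2 φ * pderiv 3 ψ - pderiv 3 φ * pderiv 2 ψ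

/-- The ℂ-algebra involution of `ℂ[x₁,x₂,x₃,x₄]` determined on the variables by
`(x₁,x₂,x₃,x₄) ↦ (−x₁,−x₂,x₃,x₄)`. -/
noncomputable def bAut : MvPolynomial (Fin 4) ℂ ≃ₐ[ℂ] MvPolynomial (Fin 4) ℂ :=
  AlgEquiv.ofAlgHom (aeval ![-X 0, -X 1, X 2, X 3]) (aeval ![-X 0, -X 1, X 2, X 3])
    (by apply algHom_ext; intro i; fin_cases i <;> simp)
    (by apply algHom_ext; intro i; fin_cases i <;> simp)

/-- The ℂ-algebra involution of `ℂ[x₁,x₂,x₃,x₄]` determined on the variables by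
`(x₁,x₂,x₃,x₄) ↦ (x₁,x₂,−x₃,−x₄)`. -/
noncomputable def cAut : MvPolynomial (Fin 4) ℂ ≃ₐ[ℂ] MvPolynomial (Fin 4) ℂ :=
  AlgEquiv.ofAlgHom (aeval ![X 0, X 1, -X 2, -X 3]) (aeval ![X 0, X 1, -X 2, -X 3])
    (by apply algHom_ext; intro i; fin_cases i <;> simp)
    (by apply algHom_ext; intro i; fin_cases i <;> simp)

/-- The ℂ-algebra involution of `ℂ[x₁,x₂,x₃,x₄]` determined on the variables by
`(x₁,x₂,x₃,x₄) ↦ (x₃,x₄,x₁,x₂)`. -/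
noncomputable def eAut : MvPolynomial (Fin 4) ℂ ≃ₐ[ℂ] MvPolynomial (Fin 4) ℂ :=
  AlgEquiv.ofAlgHom (aeval ![X 2, X 3, X 0, X 1]) (aeval ![X 2, X 3, X 0, X 1])
    (by apply algHom_ext; intro i; fin_cases i <;> simp)
    (by apply algHom_ext; intro i; fin_cases i <;> simp)

/-- The group `G = ⟨b, c, e⟩` of ℂ-algebra automorphisms of `ℂ[x₁,x₂,x₃,x₄]`. -/
noncomputable def Ggrp : Subgroup (MvPolynomial (Fin 4) ℂ ≃ₐ[ℂ] MvPolynomial (Fin 4) ℂ) :=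
  Subgroup.closure {bAut, cAut, eAut}

/-- The multiplication of the skew group algebra `A = R#G` for `R = ℂ[x₁,x₂,x₃,x₄]`
and `G = ⟨b, c, e⟩`: the underlying ℂ-vector space of `A` is the space of finitely
supported functions `G →₀ R` (write `r·δ_g` for `Finsupp.single g r`) and the
product is determined by `(r·δ_g)(s·δ_h) = (r · g(s))·δ_{g h}`. -/
noncomputable def skewMul (f₁ f₂ : Ggrp →₀ MvPolynomial (Fin 4) ℂ) :
    Ggrp →₀ MvPolynomial (Fin 4) ℂ :=
  f₁.sum fun a r => f₂.sum fun b s => Finsupp.single (a * b) (r * (a : _ ≃ₐ[ℂ] _) s)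

/-- `[A,A]`, the ℂ-linear span in `A = R#G` of all commutators `x*y − y*x`. -/
noncomputable def commutatorSpan :
    Submodule ℂ (Ggrp →₀ MvPolynomial (Fin 4) ℂ) :=
  Submodule.span ℂ
    {z : Ggrp →₀ MvPolynomial (Fin 4) ℂ | ∃ x y, z = skewMul x y - skewMul y x}

/-! ### The generators of the group and partial derivatives at the origin -/

theorem bAut_mem : bAut ∈ Ggrp := Subgroup.subset_closure (by simp)

theorem cAut_mem : cAut ∈ Ggrp := Subgroup.subset_closure (by simp)

theorem eAut_mem : eAut ∈ Ggrp := Subgroup.subset_closure (by simp)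

/-- The reflection `b` as an element of the group. -/
noncomputable def bElt : Ggrp := ⟨bAut, bAut_mem⟩

/-- The reflection `c` as an element of the group. -/
noncomputable def cElt : Ggrp := ⟨cAut, cAut_mem⟩

/-- The swap `e` as an element of the group. -/
noncomputable def eElt : Ggrp := ⟨eAut, eAut_mem⟩

theorem bAut_X (i : Fin 4) : bAut (X i) = ![-X 0, -X 1, X 2, X 3] i := by
  simp [bAut]

theorem cAut_X (i : Fin 4) : cAut (X i) = ![X 0, X 1, -X 2, -X 3] i := by
  simp [cAut]

theorem eAut_X (i : Fin 4) : eAut (X i) = ![X 2, X 3, X 0, X 1] i := by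
  simp [eAut]

theorem algEquiv_ext_X {f g : MvPolynomial (Fin 4) ℂ ≃ₐ[ℂ] MvPolynomial (Fin 4) ℂ}
    (h : ∀ i, f (X i) = g (X i)) : f = g := by
  apply AlgEquiv.coe_toAlgHom_injective
  exact algHom_ext h

theorem bElt_mul_self : bElt * bElt = 1 := by
  apply Subtype.ext
  apply algEquiv_ext_X
  intro i
  fin_cases i <;> simp [bElt, bAut_X]

theorem eElt_mul_self : eElt * eElt = 1 := by
  apply Subtype.ext
  apply algEquiv_ext_X
  intro i
  fin_cases i <;> simp [eElt, eAut_X]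

theorem bElt_mul_cElt : bElt * cElt = cElt * bElt := by
  apply Subtype.ext
  apply algEquiv_ext_X
  intro i
  fin_cases i <;> simp [bElt, cElt, bAut_X, cAut_X]

theorem eElt_mul_bElt : eElt * bElt = cElt * eElt := by
  apply Subtype.ext
  apply algEquiv_ext_X
  intro i
  fin_cases i <;> simp [bElt, cElt, eElt, bAut_X, cAut_X, eAut_X]

theorem bElt_ne_cElt : bElt ≠ cElt := by
  intro h
  have h₁ : bAut (X 0) = cAut (X 0) := congrArg (fun g : Ggrp => g.1 (X 0)) h
  have h₂ := congrArg (eval (1 : Fin 4 → ℂ)) h₁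
  norm_num [bAut_X, cAut_X] at h₂

theorem constantCoeff_map {g : MvPolynomial (Fin 4) ℂ ≃ₐ[ℂ] MvPolynomial (Fin 4) ℂ}
    (hg : ∀ i, constantCoeff (g (X i)) = 0) (r : MvPolynomial (Fin 4) ℂ) :
    constantCoeff (g r) = constantCoeff r := by
  induction r using MvPolynomial.induction_on with
  | C a => rw [← algebraMap_eq, AlgEquiv.commutes]
  | add p q hp hq => simp [hp, hq]
  | mul_X p j hp => simp [hg]

theorem constantCoeff_bAut (r : MvPolynomial (Fin 4) ℂ) :
    constantCoeff (bAut r) = constantCoeff r :=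
  constantCoeff_map (fun i => by fin_cases i <;> simp [bAut_X]) r

theorem constantCoeff_cAut (r : MvPolynomial (Fin 4) ℂ) :
    constantCoeff (cAut r) = constantCoeff r :=
  constantCoeff_map (fun i => by fin_cases i <;> simp [cAut_X]) r

theorem constantCoeff_eAut (r : MvPolynomial (Fin 4) ℂ) :
    constantCoeff (eAut r) = constantCoeff r :=
  constantCoeff_map (fun i => by fin_cases i <;> simp [eAut_X]) r

theorem pderiv_bAut (i : Fin 4) (r : MvPolynomial (Fin 4) ℂ) :
    pderiv i (bAut r) = (![-1, -1, 1, 1] i : ℂ) • bAut (pderiv i r) := by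
  induction r using MvPolynomial.induction_on with
  | C a => rw [← algebraMap_eq, AlgEquiv.commutes]; simp
  | add p q hp hq => simp [hp, hq]
  | mul_X p j hp =>
    fin_cases i <;> fin_cases j <;> simp_all [bAut_X, pderiv_X, add_comm]

theorem pderiv_cAut (i : Fin 4) (r : MvPolynomial (Fin 4) ℂ) :
    pderiv i (cAut r) = (![1, 1, -1, -1] i : ℂ) • cAut (pderiv i r) := by
  induction r using MvPolynomial.induction_on with
  | C a => rw [← algebraMap_eq, AlgEquiv.commutes]; simp
  | add p q hp hq => simp [hp, hq]
  | mul_X p j hp =>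
    fin_cases i <;> fin_cases j <;> simp_all [cAut_X, pderiv_X, add_comm]

theorem pderiv_eAut (i : Fin 4) (r : MvPolynomial (Fin 4) ℂ) :
    pderiv i (eAut r) = eAut (pderiv (![2, 3, 0, 1] i) r) := by
  induction r using MvPolynomial.induction_on with
  | C a => rw [← algebraMap_eq, AlgEquiv.commutes]; simp
  | add p q hp hq => simp [hp, hq]
  | mul_X p j hp =>
    fin_cases i <;> fin_cases j <;> simp_all [eAut_X, pderiv_X]

/-- The mixed second partial derivative at the origin. -/
noncomputable def mixedDeriv (i j : Fin 4) : MvPolynomial (Fin 4) ℂ →ₗ[ℂ] ℂ :=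
  lcoeff ℂ 0 ∘ₗ (pderiv i).toLinearMap ∘ₗ (pderiv j).toLinearMap

theorem mixedDeriv_apply (i j : Fin 4) (r : MvPolynomial (Fin 4) ℂ) :
    mixedDeriv i j r = constantCoeff (pderiv i (pderiv j r)) := by
  simp [mixedDeriv, constantCoeff_eq]

theorem poissonBracket_invariant_quadrics :
    poissonBracket (X 0 * X 0 + X 2 * X 2) (X 1 * X 1 + X 3 * X 3) =
      C 4 * (X 0 * X 1 + X 2 * X 3) := by
  rw [show (C 4 : MvPolynomial (Fin 4) ℂ) = 4 from map_ofNat C 4]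
  simp [poissonBracket, pderiv_X]
  ring

/-! ### Products and traces in the skew group algebra -/

theorem skewMul_single_left_apply (g : Ggrp) (r : MvPolynomial (Fin 4) ℂ)
    (a : Ggrp →₀ MvPolynomial (Fin 4) ℂ) (k : Ggrp) :
    skewMul (Finsupp.single g r) a k = r * g.1 (a (g⁻¹ * k)) := by
  classical
  induction a using Finsupp.induction_linear with
  | zero => simp [skewMul]
  | add f h hf hh =>
    have : skewMul (Finsupp.single g r) (f + h) =
        skewMul (Finsupp.single g r) f + skewMul (Finsupp.single g r) h := by
      simp only [skewMul]
      rw [Finsupp.sum_single_index (by simp), Finsupp.sum_single_index (by simp),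
        Finsupp.sum_single_index (by simp)]
      exact Finsupp.sum_add_index' (by simp) (by simp [mul_add])
    simp [this, hf, hh, mul_add]
  | single h s =>
    by_cases hk : h = g⁻¹ * k
    · subst hk
      simp [skewMul]
    · have : g * h ≠ k := fun e => hk (by simp [← e])
      simp [skewMul, hk, this]

theorem skewMul_single_right_apply (h : Ggrp) (s : MvPolynomial (Fin 4) ℂ)
    (a : Ggrp →₀ MvPolynomial (Fin 4) ℂ) (k : Ggrp) :
    skewMul a (Finsupp.single h s) k = a (k * h⁻¹) * (k * h⁻¹).1 s := by
  classical
  induction a using Finsupp.induction_linear with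
  | zero => simp [skewMul]
  | add f g hf hg =>
    have : skewMul (f + g) (Finsupp.single h s) =
        skewMul f (Finsupp.single h s) + skewMul g (Finsupp.single h s) := by
      simp only [skewMul]
      exact Finsupp.sum_add_index' (by simp) (by intros; simp [add_mul])
    simp [this, hf, hg, add_mul]
  | single g r =>
    by_cases hk : g = k * h⁻¹
    · subst hk
      simp [skewMul]
    · have : g * h ≠ k := fun e => hk (by simp [← e])
      simp [skewMul, hk, this]

theorem skewMul_single_single (g h : Ggrp) (r s : MvPolynomial (Fin 4) ℂ) :
    skewMul (Finsupp.single g r) (Finsupp.single h s) = Finsupp.single (g * h) (r * g.1 s) := by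
  simp [skewMul]

theorem conj_invariant_of_generators (l : Ggrp → MvPolynomial (Fin 4) ℂ →ₗ[ℂ] ℂ)
    (hb : ∀ m r, l (bElt * m * bElt⁻¹) (bAut r) = l m r)
    (hc : ∀ m r, l (cElt * m * cElt⁻¹) (cAut r) = l m r)
    (he : ∀ m r, l (eElt * m * eElt⁻¹) (eAut r) = l m r) (k m : Ggrp)
    (r : MvPolynomial (Fin 4) ℂ) : l (k * m * k⁻¹) (k.1 r) = l m r := by
  obtain ⟨k, hk⟩ := k
  revert m r
  induction hk using Subgroup.closure_induction with
  | mem x hx =>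
    intro m r
    rcases hx with rfl | rfl | rfl
    exacts [hb m r, hc m r, he m r]
  | one => intro m r; exact congrArg (fun n => l n r) (by group : 1 * m * 1⁻¹ = m)
  | mul x y hx hy ihx ihy =>
    intro m r
    rw [← ihy m r, ← ihx (⟨y, hy⟩ * m * (⟨y, hy⟩ : Ggrp)⁻¹)]
    have h : (⟨x, hx⟩ * ⟨y, hy⟩ : Ggrp) * m * (⟨x, hx⟩ * ⟨y, hy⟩ : Ggrp)⁻¹ =
        ⟨x, hx⟩ * (⟨y, hy⟩ * m * (⟨y, hy⟩ : Ggrp)⁻¹) * (⟨x, hx⟩ : Ggrp)⁻¹ := by group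
    exact congrArg (fun n => l n (x (y r))) h
  | inv x hx ih =>
    intro m r
    rw [← ih]
    have h₁ : (⟨x, hx⟩ : Ggrp) * ((⟨x, hx⟩ : Ggrp)⁻¹ * m * (⟨x, hx⟩ : Ggrp)⁻¹⁻¹) *
        (⟨x, hx⟩ : Ggrp)⁻¹ = m := by group
    have h₂ : x (x⁻¹ r) = r := by rw [← AlgEquiv.mul_apply]; simp
    exact congrArg₂ (fun n s => l n s) h₁ h₂

/-- A conjugation-invariant family of functionals, each blind to the twist by its own group
element, defines a trace on the skew group algebra. -/
theorem lsum_commutatorSpan (l : Ggrp → MvPolynomial (Fin 4) ℂ →ₗ[ℂ] ℂ)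
    (hconj : ∀ k m r, l (k * m * k⁻¹) (k.1 r) = l m r)
    (htwist : ∀ m y s, l m (y * m.1 s) = l m (y * s)) {z : Ggrp →₀ MvPolynomial (Fin 4) ℂ}
    (hz : z ∈ commutatorSpan) : Finsupp.lsum ℂ l z = 0 := by
  suffices h : commutatorSpan ≤ LinearMap.ker (Finsupp.lsum ℂ l) from h hz
  refine Submodule.span_le.2 ?_
  rintro _ ⟨x, y, rfl⟩
  have hs : ∀ x y, Finsupp.lsum ℂ l (skewMul x y) =
      x.sum fun g r => y.sum fun h s => l (g * h) (r * g.1 s) := by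
    intro x y
    simp only [skewMul, map_finsuppSum, Finsupp.lsum_single]
  simp only [SetLike.mem_coe, LinearMap.mem_ker, map_sub, hs, sub_eq_zero]
  rw [Finsupp.sum_comm]
  refine Finsupp.sum_congr fun h _ => Finsupp.sum_congr fun g _ => ?_
  rw [← hconj h, ← mul_assoc, mul_inv_cancel_right, map_mul, ← AlgEquiv.mul_apply,
    ← Subgroup.coe_mul, htwist, mul_comm]

open Classical in
/-- The functional on the sector of the identity summing the coefficients of `x₁x₂` and
`x₃x₄`. -/
noncomputable def identityFunctional (m : Ggrp) : MvPolynomial (Fin 4) ℂ →ₗ[ℂ] ℂ :=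
  if m = 1 then mixedDeriv 0 1 + mixedDeriv 2 3 else 0

open Classical in
/-- The functional on the sectors of `b` and `c` taking the coefficients of `x₃x₄` and `x₁x₂`
respectively. -/
noncomputable def reflectionFunctional (m : Ggrp) : MvPolynomial (Fin 4) ℂ →ₗ[ℂ] ℂ :=
  (if m = bElt then mixedDeriv 2 3 else 0) + if m = cElt then mixedDeriv 0 1 else 0

@[simp]
theorem reflectionFunctional_bElt : reflectionFunctional bElt = mixedDeriv 2 3 := by
  rw [reflectionFunctional, if_pos rfl, if_neg bElt_ne_cElt, add_zero]

@[simp]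
theorem reflectionFunctional_cElt : reflectionFunctional cElt = mixedDeriv 0 1 := by
  rw [reflectionFunctional, if_pos rfl, if_neg bElt_ne_cElt.symm, zero_add]

theorem reflectionFunctional_of_ne {m : Ggrp} (hb : m ≠ bElt) (hc : m ≠ cElt) :
    reflectionFunctional m = 0 := by
  rw [reflectionFunctional, if_neg hb, if_neg hc, add_zero]

theorem identityFunctional_commutatorSpan {z : Ggrp →₀ MvPolynomial (Fin 4) ℂ}
    (hz : z ∈ commutatorSpan) : Finsupp.lsum ℂ identityFunctional z = 0 := by
  refine lsum_commutatorSpan _ (conj_invariant_of_generators _ ?_ ?_ ?_) ?_ hz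
  · intro m r
    by_cases hm : m = 1 <;>
      simp [identityFunctional, hm, mixedDeriv_apply, pderiv_bAut, constantCoeff_bAut]
  · intro m r
    by_cases hm : m = 1 <;>
      simp [identityFunctional, hm, mixedDeriv_apply, pderiv_cAut, constantCoeff_cAut]
  · intro m r
    by_cases hm : m = 1 <;>
      simp [identityFunctional, hm, mixedDeriv_apply, pderiv_eAut, constantCoeff_eAut, add_comm]
  · intro m y s
    by_cases hm : m = 1 <;> simp [identityFunctional, hm]

theorem reflectionFunctional_commutatorSpan {z : Ggrp →₀ MvPolynomial (Fin 4) ℂ}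
    (hz : z ∈ commutatorSpan) : Finsupp.lsum ℂ reflectionFunctional z = 0 := by
  have hcb := mul_inv_eq_of_eq_mul bElt_mul_cElt
  have hbc := mul_inv_eq_of_eq_mul bElt_mul_cElt.symm
  have heb := mul_inv_eq_of_eq_mul eElt_mul_bElt
  have hec : eElt * cElt * eElt⁻¹ = bElt := by
    have he := inv_eq_of_mul_eq_one_right eElt_mul_self
    rw [← heb, he, ← mul_assoc, ← mul_assoc, eElt_mul_self, one_mul, mul_assoc, eElt_mul_self,
      mul_one]
  have hother : ∀ k m n p : Ggrp, k * n * k⁻¹ = p → m ≠ n → k * m * k⁻¹ ≠ p := by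
    rintro k m n p rfl hmn
    simpa using hmn
  refine lsum_commutatorSpan _ (conj_invariant_of_generators _ ?_ ?_ ?_) ?_ hz
  · intro m r
    rcases eq_or_ne m bElt with rfl | hb
    · simp [mul_inv_cancel_right, mixedDeriv_apply, pderiv_bAut, constantCoeff_bAut]
    rcases eq_or_ne m cElt with rfl | hc
    · simp [hcb, mixedDeriv_apply, pderiv_bAut, constantCoeff_bAut]
    · rw [reflectionFunctional_of_ne hb hc, reflectionFunctional_of_ne
        (hother bElt m bElt bElt (by simp) hb)
        (hother bElt m cElt cElt hcb hc)]
      rfl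
  · intro m r
    rcases eq_or_ne m bElt with rfl | hb
    · simp [hbc, mixedDeriv_apply, pderiv_cAut, constantCoeff_cAut]
    rcases eq_or_ne m cElt with rfl | hc
    · simp [mul_inv_cancel_right, mixedDeriv_apply, pderiv_cAut, constantCoeff_cAut]
    · rw [reflectionFunctional_of_ne hb hc, reflectionFunctional_of_ne
        (hother cElt m bElt bElt hbc hb)
        (hother cElt m cElt cElt (by simp) hc)]
      rfl
  · intro m r
    rcases eq_or_ne m bElt with rfl | hb
    · simp [heb, mixedDeriv_apply, pderiv_eAut, constantCoeff_eAut]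
    rcases eq_or_ne m cElt with rfl | hc
    · simp [hec, mixedDeriv_apply, pderiv_eAut, constantCoeff_eAut]
    · rw [reflectionFunctional_of_ne hb hc, reflectionFunctional_of_ne
        (hother eElt m cElt bElt hec hc)
        (hother eElt m bElt cElt heb hb)]
      rfl
  · intro m y s
    rcases eq_or_ne m bElt with rfl | hb
    · rw [reflectionFunctional_bElt]
      simp [mixedDeriv_apply, bElt, pderiv_bAut, constantCoeff_bAut]
    rcases eq_or_ne m cElt with rfl | hc
    · rw [reflectionFunctional_cElt]
      simp [mixedDeriv_apply, cElt, pderiv_cAut, constantCoeff_cAut]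
    · simp [reflectionFunctional_of_ne hb hc]

theorem lsum_identityFunctional (z : Ggrp →₀ MvPolynomial (Fin 4) ℂ) :
    Finsupp.lsum ℂ identityFunctional z = mixedDeriv 0 1 (z 1) + mixedDeriv 2 3 (z 1) := by
  classical
  induction z using Finsupp.induction_linear with
  | zero => simp
  | add f g hf hg => simp only [map_add, hf, hg, Finsupp.add_apply]; ring
  | single g r =>
    by_cases h : g = 1 <;> simp [identityFunctional, h]

theorem lsum_reflectionFunctional (z : Ggrp →₀ MvPolynomial (Fin 4) ℂ) :
    Finsupp.lsum ℂ reflectionFunctional z =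
      mixedDeriv 2 3 (z bElt) + mixedDeriv 0 1 (z cElt) := by
  classical
  induction z using Finsupp.induction_linear with
  | zero => simp
  | add f g hf hg => simp only [map_add, hf, hg, Finsupp.add_apply]; ring
  | single g r =>
    rcases eq_or_ne g bElt with rfl | hb
    · simp [bElt_ne_cElt]
    rcases eq_or_ne g cElt with rfl | hc
    · simp [bElt_ne_cElt.symm]
    · simp [reflectionFunctional_of_ne hb hc, hb, hc]

theorem mem_invariants_of_generators {r : MvPolynomial (Fin 4) ℂ} (hb : bAut r = r)
    (hc : cAut r = r) (he : eAut r = r) : ∀ g ∈ Ggrp, g r = r := by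
  intro g hg
  induction hg using Subgroup.closure_induction with
  | mem x hx =>
    rcases hx with rfl | rfl | rfl
    exacts [hb, hc, he]
  | one => rfl
  | mul x y _ _ hx hy => rw [AlgEquiv.mul_apply, hy, hx]
  | inv x _ hx =>
    conv_lhs => rw [← hx]
    rw [← AlgEquiv.mul_apply]
    simp

/-! ### Derivations of the skew group algebra -/

section Derivation

variable {d : (Ggrp →₀ MvPolynomial (Fin 4) ℂ) →ₗ[ℂ] (Ggrp →₀ MvPolynomial (Fin 4) ℂ)}

/-- The component of a derivation at `g` is a `g`-twisted derivation on polynomials. -/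
theorem derivation_apply_mul
    (hd : ∀ x y, d (skewMul x y) = skewMul (d x) y + skewMul x (d y))
    (r s : MvPolynomial (Fin 4) ℂ) (g : Ggrp) :
    d (Finsupp.single 1 (r * s)) g =
      d (Finsupp.single 1 r) g * g.1 s + r * d (Finsupp.single 1 s) g := by
  have h := hd (Finsupp.single 1 r) (Finsupp.single 1 s)
  rw [skewMul_single_single] at h
  simpa [skewMul_single_left_apply, skewMul_single_right_apply] using DFunLike.congr_fun h g

theorem derivation_apply_eq_zero
    (hd : ∀ x y, d (skewMul x y) = skewMul (d x) y + skewMul x (d y))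
    {r s : MvPolynomial (Fin 4) ℂ} {g : Ggrp} (hr : g.1 r = r) (hs : g.1 s ≠ s) :
    d (Finsupp.single 1 r) g = 0 := by
  have h₁ := derivation_apply_mul hd r s g
  have h₂ := derivation_apply_mul hd s r g
  rw [mul_comm s r, h₁, hr] at h₂
  have h₃ : d (Finsupp.single 1 r) g * (g.1 s - s) = 0 := by linear_combination h₂
  exact (mul_eq_zero.1 h₃).resolve_right (sub_ne_zero.2 hs)

theorem lsum_reflectionFunctional_derivation_invariant
    (hd : ∀ x y, d (skewMul x y) = skewMul (d x) y + skewMul x (d y))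
    {r : MvPolynomial (Fin 4) ℂ} (hb : bAut r = r) (hc : cAut r = r) :
    Finsupp.lsum ℂ reflectionFunctional (d (Finsupp.single 1 r)) = 0 := by
  have h₁ : d (Finsupp.single 1 r) bElt = 0 := by
    refine derivation_apply_eq_zero hd hb (s := X 0) fun h => ?_
    have := congrArg (eval (1 : Fin 4 → ℂ)) h
    norm_num [bElt, bAut_X] at this
  have h₂ : d (Finsupp.single 1 r) cElt = 0 := by
    refine derivation_apply_eq_zero hd hc (s := X 2) fun h => ?_
    have := congrArg (eval (1 : Fin 4 → ℂ)) h
    rw [show cElt.1 (X 2) = -X 2 by simp [cElt, cAut_X]] at this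
    norm_num at this
  simp [lsum_reflectionFunctional, h₁, h₂]

theorem lsum_reflectionFunctional_derivation
    (hd : ∀ x y, d (skewMul x y) = skewMul (d x) y + skewMul x (d y)) :
    Finsupp.lsum ℂ reflectionFunctional (d (Finsupp.single bElt (X 3 * X 3))) =
      2 * constantCoeff (pderiv 2 (d (Finsupp.single 1 (X 3)) 1)) := by
  have h := hd (Finsupp.single 1 (X 3 * X 3)) (Finsupp.single bElt 1)
  have hbc : d (Finsupp.single 1 (X 3 * X 3)) (cElt * bElt⁻¹) = 0 := by
    have hX : (cElt * bElt⁻¹).1 (X 3) = -X 3 := by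
      rw [inv_eq_of_mul_eq_one_right bElt_mul_self]
      simp [cElt, bElt, bAut_X, cAut_X]
    rw [derivation_apply_mul hd, hX]
    ring
  rw [skewMul_single_single] at h
  simp only [one_mul, OneMemClass.coe_one, AlgEquiv.one_apply, mul_one] at h
  rw [h, lsum_reflectionFunctional]
  simp only [Finsupp.add_apply, skewMul_single_left_apply, skewMul_single_right_apply, hbc,
    mul_inv_cancel, derivation_apply_mul hd]
  simp [mixedDeriv_apply, pderiv_X]
  ring

/-- Compatibility with the swap `e` makes the component of a derivation at the identity
symmetric. -/
theorem derivation_apply_X_three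
    (hd : ∀ x y, d (skewMul x y) = skewMul (d x) y + skewMul x (d y)) :
    d (Finsupp.single 1 (X 3)) 1 = eAut (d (Finsupp.single 1 (X 1)) 1) := by
  have h₁ := hd (Finsupp.single eElt 1) (Finsupp.single 1 (X 1))
  have h₂ := hd (Finsupp.single 1 (X 3)) (Finsupp.single eElt 1)
  have he : eElt.1 (X 1) = X 3 := by simp [eElt, eAut_X]
  rw [skewMul_single_single, he] at h₁
  rw [skewMul_single_single] at h₂
  simp only [one_mul, mul_one, OneMemClass.coe_one, AlgEquiv.one_apply] at h₁ h₂
  have h := DFunLike.congr_fun (h₂.symm.trans h₁) eElt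
  simp only [Finsupp.add_apply, skewMul_single_left_apply, skewMul_single_right_apply] at h
  simp only [mul_inv_cancel, inv_one, mul_one, inv_mul_cancel, one_mul, map_one, he,
    OneMemClass.coe_one, AlgEquiv.one_apply] at h
  change _ = eElt.1 _
  linear_combination h

theorem lsum_identityFunctional_derivation
    (hd : ∀ x y, d (skewMul x y) = skewMul (d x) y + skewMul x (d y)) :
    Finsupp.lsum ℂ identityFunctional (d (Finsupp.single 1 (X 1 * X 1 + X 3 * X 3))) =
      4 * constantCoeff (pderiv 2 (d (Finsupp.single 1 (X 3)) 1)) := by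
  rw [Finsupp.single_add, map_add, lsum_identityFunctional]
  simp [-Finsupp.single_mul, derivation_apply_mul hd, mixedDeriv_apply, pderiv_X,
    derivation_apply_X_three hd, pderiv_eAut, constantCoeff_eAut]
  ring

end Derivation

/-- **the paper's main result.** Let `A = ℂ[x₁,x₂,x₃,x₄]#G` with
`G = ⟨b, c, e⟩`, let `Q = A/[A,A]` and `π : A → Q` the projection. There is no
ℂ-bilinear bracket `⟨−,−⟩` on `Q` that is (i) alternating, (ii) satisfies the
Jacobi identity, (iii) is such that each `⟨π a, −⟩` is induced by a ℂ-linear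
derivation of `A`, and (iv) extends the standard symplectic Poisson bracket on
the invariant ring `ℂ[V]^G ⊆ A/[A,A]`. -/
theorem stmt_12 :
    ¬ ∃ br : ((Ggrp →₀ MvPolynomial (Fin 4) ℂ) ⧸ commutatorSpan) →ₗ[ℂ]
        ((Ggrp →₀ MvPolynomial (Fin 4) ℂ) ⧸ commutatorSpan) →ₗ[ℂ]
        ((Ggrp →₀ MvPolynomial (Fin 4) ℂ) ⧸ commutatorSpan),
      (∀ q, br q q = 0) ∧
      (∀ q r s, br q (br r s) + br r (br s q) + br s (br q r) = 0) ∧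
      (∀ a : Ggrp →₀ MvPolynomial (Fin 4) ℂ,
        ∃ d : (Ggrp →₀ MvPolynomial (Fin 4) ℂ) →ₗ[ℂ]
            (Ggrp →₀ MvPolynomial (Fin 4) ℂ),
          (∀ x y, d (skewMul x y) = skewMul (d x) y + skewMul x (d y)) ∧
          (∀ x, br (commutatorSpan.mkQ a) (commutatorSpan.mkQ x) =
            commutatorSpan.mkQ (d x))) ∧
      (∀ φ ψ : MvPolynomial (Fin 4) ℂ,
        (∀ g ∈ Ggrp, g φ = φ) → (∀ g ∈ Ggrp, g ψ = ψ) →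
        br (commutatorSpan.mkQ (Finsupp.single (1 : Ggrp) φ))
            (commutatorSpan.mkQ (Finsupp.single (1 : Ggrp) ψ)) =
          commutatorSpan.mkQ (Finsupp.single (1 : Ggrp) (poissonBracket φ ψ))) := by
  rintro ⟨br, halt, -, hder, hext⟩
  have hφ₁ : bAut (X 0 * X 0 + X 2 * X 2) = X 0 * X 0 + X 2 * X 2 := by simp [bAut_X]
  have hφ₂ : cAut (X 0 * X 0 + X 2 * X 2) = X 0 * X 0 + X 2 * X 2 := by simp [cAut_X]
  have hφ := mem_invariants_of_generators hφ₁ hφ₂ (by simp [eAut_X, add_comm])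
  have hψ := mem_invariants_of_generators (r := X 1 * X 1 + X 3 * X 3)
    (by simp [bAut_X]) (by simp [cAut_X]) (by simp [eAut_X, add_comm])
  obtain ⟨D, hD, hbrD⟩ := hder (Finsupp.single 1 (X 0 * X 0 + X 2 * X 2))
  obtain ⟨d, hd, hbrd⟩ := hder (Finsupp.single bElt (X 3 * X 3))
  have hskew := LinearMap.IsAlt.neg (B := br) halt
  have hD_reflection : constantCoeff (pderiv 2 (D (Finsupp.single 1 (X 3)) 1)) = 0 := by
    have h := hskew (commutatorSpan.mkQ (Finsupp.single 1 (X 0 * X 0 + X 2 * X 2)))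
      (commutatorSpan.mkQ (Finsupp.single bElt (X 3 * X 3)))
    rw [hbrD, hbrd, ← map_neg, ← sub_eq_zero, ← map_sub, ← LinearMap.mem_ker,
      Submodule.ker_mkQ] at h
    have h' := reflectionFunctional_commutatorSpan h
    rw [map_sub, map_neg, lsum_reflectionFunctional_derivation hD,
      lsum_reflectionFunctional_derivation_invariant hd hφ₁ hφ₂] at h'
    simpa using h'
  have h := hext _ _ hφ hψ
  rw [hbrD, ← sub_eq_zero, ← map_sub, ← LinearMap.mem_ker, Submodule.ker_mkQ] at h
  have h' := identityFunctional_commutatorSpan h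
  rw [map_sub, lsum_identityFunctional_derivation hD, hD_reflection,
    lsum_identityFunctional, Finsupp.single_eq_same, poissonBracket_invariant_quadrics] at h'
  simp [mixedDeriv_apply, pderiv_X] at h'
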